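/- Let Z be a QM witness on H_A ⊗ H_B ⊗ H_C, i.e. a Hermitian matrix with Tr(Z Ω) ≥ 0 for every Ω with classical memory, and set Z₀ := (id_A / d_A) ⊗ Tr_A Z. Then: (a) Tr(Z₀ W) ≥ 0 for every TPM process matrix W; and (b) there exist a real number κ and an entanglement retriever Θ satisfying Tr_A Θ = (1/d_B) · id_{B⊗C} such that Z = Z₀ + κ · (Θ − id/(d_A · d_B)). -/

import Mathlib

open Matrix Kronecker BigOperators ComplexOrder

noncomputable section

/-- Partial trace over the second (right) tensor factor. -/
def ptrR {α : Type*} {n : ℕ} (M : Matrix (α × Fin n) (α × Fin n) ℂ) : Matrix α α ℂ :=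
  Matrix.of fun i j => ∑ k, M (i, k) (j, k)

/-- Partial trace over the first (left) tensor factor. -/
def ptrL {m : ℕ} {β : Type*} (M : Matrix (Fin m × β) (Fin m × β) ℂ) : Matrix β β ℂ :=
  Matrix.of fun i j => ∑ k, M (k, i) (k, j)

/-- Partial trace over the last factor `C` of a matrix on `A ⊗ B ⊗ C`. -/
def trC3 {a b c : ℕ} (M : Matrix (Fin a × Fin b × Fin c) (Fin a × Fin b × Fin c) ℂ) :
    Matrix (Fin a × Fin b) (Fin a × Fin b) ℂ :=
  Matrix.of fun x y => ∑ k, M (x.1, x.2, k) (y.1, y.2, k)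

/-- Partial trace over the last two factors `B ⊗ C` of a matrix on `A ⊗ B ⊗ C`. -/
def trBC3 {a b c : ℕ} (M : Matrix (Fin a × Fin b × Fin c) (Fin a × Fin b × Fin c) ℂ) :
    Matrix (Fin a) (Fin a) ℂ :=
  Matrix.of fun i j => ∑ β : Fin b, ∑ γ : Fin c, M (i, β, γ) (j, β, γ)

/-- A matrix on `H_A ⊗ H_B ⊗ H_C` has classical memory if it is a convex combination of
products `ρ_λ ⊗ N_λ` of density matrices with Choi matrices of channels. -/
def ClassicalMemory {a b c : ℕ}
    (W : Matrix (Fin a × Fin b × Fin c) (Fin a × Fin b × Fin c) ℂ) : Prop :=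
  ∃ (k : ℕ) (p : Fin k → ℝ) (ρ : Fin k → Matrix (Fin a) (Fin a) ℂ)
    (N : Fin k → Matrix (Fin b × Fin c) (Fin b × Fin c) ℂ),
    (∀ l, 0 ≤ p l) ∧ (∑ l, p l) = 1 ∧
    (∀ l, (ρ l).PosSemidef ∧ (ρ l).trace = 1) ∧
    (∀ l, (N l).PosSemidef ∧ ptrR (N l) = 1) ∧
    W = ∑ l, (p l : ℂ) • ((ρ l) ⊗ₖ (N l))

/-- An entanglement retriever. -/
def IsER {a b c : ℕ} (Θ : Matrix (Fin a × Fin b × Fin c) (Fin a × Fin b × Fin c) ℂ) : Prop :=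
  Θ.PosSemidef ∧ ∃ η : Matrix (Fin b) (Fin b) ℂ, η.PosSemidef ∧ η.trace = 1 ∧
    ((η ⊗ₖ (1 : Matrix (Fin c) (Fin c) ℂ)) - ptrL Θ).PosSemidef

/-- A valid TPM process matrix. -/
def IsTPM {a b c : ℕ} (W : Matrix (Fin a × Fin b × Fin c) (Fin a × Fin b × Fin c) ℂ) : Prop :=
  W.PosSemidef ∧ W.trace = (b : ℂ) ∧
    (b : ℂ) • trC3 W = (trBC3 W) ⊗ₖ (1 : Matrix (Fin b) (Fin b) ℂ)

/-- The partial trace over the left factor as a sum of principal submatrices. -/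
theorem ptrL_eq_sum {m : ℕ} {β : Type*} (M : Matrix (Fin m × β) (Fin m × β) ℂ) :
    ptrL M = ∑ k, M.submatrix (Prod.mk k) (Prod.mk k) := by
  ext i j
  simp [ptrL, Matrix.sum_apply]

theorem ptrL_posSemidef {m : ℕ} {β : Type*} {M : Matrix (Fin m × β) (Fin m × β) ℂ}
    (hM : M.PosSemidef) : (ptrL M).PosSemidef := by
  rw [ptrL_eq_sum]
  exact Matrix.posSemidef_sum _ fun k _ => hM.submatrix _

theorem ptrL_isHermitian {m : ℕ} {β : Type*} {M : Matrix (Fin m × β) (Fin m × β) ℂ}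
    (hM : M.IsHermitian) : (ptrL M).IsHermitian := by
  ext i j
  simp only [ptrL, Matrix.conjTranspose_apply, Matrix.of_apply, star_sum]
  exact Finset.sum_congr rfl fun k _ => hM.apply _ _

theorem ptrL_add {m : ℕ} {β : Type*} (M N : Matrix (Fin m × β) (Fin m × β) ℂ) :
    ptrL (M + N) = ptrL M + ptrL N := by
  ext i j
  simp [ptrL, Finset.sum_add_distrib]

theorem ptrL_smul {m : ℕ} {β : Type*} (c : ℂ) (M : Matrix (Fin m × β) (Fin m × β) ℂ) :
    ptrL (c • M) = c • ptrL M := by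
  ext i j
  simp [ptrL, Finset.mul_sum]

theorem ptrL_sub {m : ℕ} {β : Type*} (M N : Matrix (Fin m × β) (Fin m × β) ℂ) :
    ptrL (M - N) = ptrL M - ptrL N := by
  ext i j
  simp [ptrL, Finset.sum_sub_distrib]

theorem ptrL_kronecker {m : ℕ} {β : Type*} (P : Matrix (Fin m) (Fin m) ℂ) (N : Matrix β β ℂ) :
    ptrL (P ⊗ₖ N) = P.trace • N := by
  ext i j
  simp [ptrL, Matrix.trace, Finset.sum_mul]

theorem trace_one_kronecker_mul {m : ℕ} {β : Type*} [Fintype β] (N : Matrix β β ℂ)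
    (W : Matrix (Fin m × β) (Fin m × β) ℂ) :
    (((1 : Matrix (Fin m) (Fin m) ℂ) ⊗ₖ N) * W).trace = (N * ptrL W).trace := by
  simp only [Matrix.trace, Matrix.diag_apply, Matrix.mul_apply, Fintype.sum_prod_type, ptrL,
    Matrix.kroneckerMap_apply, Matrix.of_apply, Matrix.one_apply, ite_mul, one_mul, zero_mul,
    Finset.mul_sum]
  rw [Finset.sum_comm]
  refine Finset.sum_congr rfl fun i _ => ?_
  simpa using Finset.sum_comm

theorem IsTPM.ptrR_ptrL {a b c : ℕ} (hb : 0 < b)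
    {W : Matrix (Fin a × Fin b × Fin c) (Fin a × Fin b × Fin c) ℂ} (hW : IsTPM W) :
    ptrR (ptrL W) = 1 := by
  obtain ⟨-, htr, hC⟩ := hW
  have hb' : (b : ℂ) ≠ 0 := by exact_mod_cast hb.ne'
  have hcomm : ptrR (ptrL W) = ptrL (trC3 W) := by
    ext i j
    simp only [ptrR, ptrL, trC3, Matrix.of_apply]
    exact Finset.sum_comm
  have htrA : (trBC3 W).trace = (b : ℂ) := by
    rw [← htr]
    simp [trBC3, Matrix.trace, Fintype.sum_prod_type]
  have h : (b : ℂ) • ptrL (trC3 W) = (b : ℂ) • 1 := by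
    rw [← ptrL_smul, hC, ptrL_kronecker, htrA]
  rw [hcomm]
  exact smul_right_injective _ hb' h

theorem trace_maximallyMixed (n : ℕ) (hn : 0 < n) :
    ((n : ℂ)⁻¹ • (1 : Matrix (Fin n) (Fin n) ℂ)).trace = 1 := by
  have hn' : (n : ℂ) ≠ 0 := by exact_mod_cast hn.ne'
  simp [hn']

theorem posSemidef_maximallyMixed (n : ℕ) :
    ((n : ℂ)⁻¹ • (1 : Matrix (Fin n) (Fin n) ℂ)).PosSemidef :=
  Matrix.PosSemidef.one.smul (by positivity)

open scoped Matrix.Norms.L2Operator MatrixOrder in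
/-- A Hermitian matrix becomes positive semidefinite after adding a large multiple of `1`. -/
theorem Matrix.IsHermitian.exists_pos_posSemidef_add_smul_one {n : Type*} [Fintype n]
    [DecidableEq n] {D : Matrix n n ℂ} (hD : D.IsHermitian) :
    ∃ r : ℝ, 0 < r ∧ (D + (r : ℂ) • 1).PosSemidef := by
  refine ⟨‖D‖ + 1, by positivity, ?_⟩
  have h := Matrix.le_iff.mp (IsSelfAdjoint.neg_algebraMap_norm_le_self (a := D) hD)
  have h1 := h.add (Matrix.PosSemidef.one (n := n) (R := ℂ))
  have h2 : D + ((‖D‖ + 1 : ℝ) : ℂ) • (1 : Matrix n n ℂ) =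
      D - -algebraMap ℝ (Matrix n n ℂ) ‖D‖ + 1 := by
    rw [sub_neg_eq_add, Algebra.algebraMap_eq_smul_one, Complex.ofReal_add, add_smul,
      Complex.coe_smul, Complex.ofReal_one, one_smul, add_assoc]
  exact h2 ▸ h1

/-- **Observation 2, converse part.** Every quantum-memory witness `Z` can
be brought into the canonical form `Z = Z₀ + κ (Θ − id/(d_A d_B))` with `Z₀` positive on
all TPM processes and `Θ` an entanglement retriever. -/
theorem stmt10 (dA dB dC : ℕ) (hdA : 0 < dA) (hdB : 0 < dB)
    (Z : Matrix (Fin dA × Fin dB × Fin dC) (Fin dA × Fin dB × Fin dC) ℂ)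
    (hZ : Z.IsHermitian)
    (hwit : ∀ Ω : Matrix (Fin dA × Fin dB × Fin dC) (Fin dA × Fin dB × Fin dC) ℂ,
      ClassicalMemory Ω → 0 ≤ ((Z * Ω).trace).re) :
    (∀ W : Matrix (Fin dA × Fin dB × Fin dC) (Fin dA × Fin dB × Fin dC) ℂ, IsTPM W →
      0 ≤ (((((dA : ℂ))⁻¹ • (1 : Matrix (Fin dA) (Fin dA) ℂ)) ⊗ₖ ptrL Z) * W).trace.re) ∧
    (∃ (κ : ℝ) (Θ : Matrix (Fin dA × Fin dB × Fin dC) (Fin dA × Fin dB × Fin dC) ℂ),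
      IsER Θ ∧ ptrL Θ = ((dB : ℂ))⁻¹ • (1 : Matrix (Fin dB × Fin dC) (Fin dB × Fin dC) ℂ) ∧
      Z = (((dA : ℂ))⁻¹ • (1 : Matrix (Fin dA) (Fin dA) ℂ)) ⊗ₖ ptrL Z +
        (κ : ℂ) • (Θ - ((dA * dB : ℕ) : ℂ)⁻¹ • 1)) := by
  have hA : (dA : ℂ) ≠ 0 := by exact_mod_cast hdA.ne'
  have hB : (dB : ℂ) ≠ 0 := by exact_mod_cast hdB.ne'
  refine ⟨fun W hW => ?_, ?_⟩
  · have hΩ : ClassicalMemory (((dA : ℂ)⁻¹ • (1 : Matrix (Fin dA) (Fin dA) ℂ)) ⊗ₖ ptrL W) :=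
      ⟨1, fun _ => 1, fun _ => (dA : ℂ)⁻¹ • 1, fun _ => ptrL W, by simp, by simp,
        fun _ => ⟨posSemidef_maximallyMixed dA, trace_maximallyMixed dA hdA⟩,
        fun _ => ⟨ptrL_posSemidef hW.1, hW.ptrR_ptrL hdB⟩, by simp⟩
    have h := hwit _ hΩ
    rw [Matrix.trace_mul_comm, Matrix.smul_kronecker, Matrix.smul_mul, Matrix.trace_smul,
      trace_one_kronecker_mul, Matrix.trace_mul_comm] at h
    rwa [Matrix.smul_kronecker, Matrix.smul_mul, Matrix.trace_smul, trace_one_kronecker_mul]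
  · set Z₀ := ((dA : ℂ)⁻¹ • (1 : Matrix (Fin dA) (Fin dA) ℂ)) ⊗ₖ ptrL Z with hZ₀
    have hZ₀H : Z₀.IsHermitian := by
      rw [Matrix.IsHermitian, hZ₀, Matrix.conjTranspose_kronecker,
        (posSemidef_maximallyMixed dA).isHermitian.eq, (ptrL_isHermitian hZ).eq]
    have hptr : ptrL (Z - Z₀) = 0 := by
      rw [ptrL_sub, hZ₀, ptrL_kronecker, trace_maximallyMixed dA hdA, one_smul, sub_self]
    obtain ⟨r, hr, hpos⟩ := (hZ.sub hZ₀H).exists_pos_posSemidef_add_smul_one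
    have hr' : (r : ℂ) ≠ 0 := by exact_mod_cast hr.ne'
    have hΘ : ptrL (((r * (dA * dB : ℕ) : ℝ) : ℂ)⁻¹ • (Z - Z₀ + (r : ℂ) • 1)) =
        (dB : ℂ)⁻¹ • (1 : Matrix (Fin dB × Fin dC) (Fin dB × Fin dC) ℂ) := by
      rw [ptrL_smul, ptrL_add, hptr, ptrL_smul, zero_add, ← Matrix.one_kronecker_one,
        ptrL_kronecker, Matrix.trace_one, smul_smul, smul_smul]
      congr 1
      push_cast [Fintype.card_fin]
      field_simp
    refine ⟨r * (dA * dB : ℕ), ((r * (dA * dB : ℕ) : ℝ) : ℂ)⁻¹ • (Z - Z₀ + (r : ℂ) • 1),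
      ⟨hpos.smul ?_, (dB : ℂ)⁻¹ • 1, posSemidef_maximallyMixed dB,
        trace_maximallyMixed dB hdB, ?_⟩, hΘ, ?_⟩
    · rw [← Complex.ofReal_inv]
      exact Complex.zero_le_real.mpr (by positivity)
    · rw [hΘ, Matrix.smul_kronecker, Matrix.one_kronecker_one, sub_self]
      exact Matrix.PosSemidef.zero
    · have h1 : ((r * (dA * dB : ℕ) : ℝ) : ℂ) ≠ 0 := by
        push_cast
        positivity
      have h2 : ((r * (dA * dB : ℕ) : ℝ) : ℂ) * ((dA * dB : ℕ) : ℂ)⁻¹ = r := by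
        push_cast
        field_simp
      rw [smul_sub, smul_smul, smul_smul, mul_inv_cancel₀ h1, h2, one_smul]
      abel
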